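/- arXiv:1510.01948 — 2 statements merged into one kernel-verified Lean document; each statement's English description precedes it below -/
import Mathlib

section
/- Let X and Y be square-integrable random vectors on a probability space taking values in ℝ^d, with means X̂ = E[X], Ŷ = E[Y] and covariance matrices Σ_X = E[(X−X̂)(X−X̂)ᵀ], Σ_Y = E[(Y−Ŷ)(Y−Ŷ)ᵀ]. Assume Σ_X and Σ_Y are positive definite. Then E[‖Y − X‖²] ≥ ‖Ŷ − X̂‖² + trace(Σ_X) + trace(Σ_Y) − 2·trace((Σ_Y^{1/2} Σ_X Σ_Y^{1/2})^{1/2}). -/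
open MeasureTheory Matrix

lemma aux_pointwise {d : ℕ} (A : Matrix (Fin d) (Fin d) ℝ) (hA : A.PosDef)
    (x y : Fin d → ℝ) : 2 * (x ⬝ᵥ y) ≤ x ⬝ᵥ (A *ᵥ x) + y ⬝ᵥ (A⁻¹ *ᵥ y) := by
  have h := hA.posSemidef.dotProduct_mulVec_nonneg (x - A⁻¹ *ᵥ y)
  have hdet : IsUnit A.det := (Matrix.isUnit_iff_isUnit_det A).1 hA.isUnit
  have h1 : A *ᵥ (A⁻¹ *ᵥ y) = y := by
    rw [Matrix.mulVec_mulVec, Matrix.mul_nonsing_inv A hdet, Matrix.one_mulVec]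
  have hT : Aᵀ = A := by
    have := hA.isHermitian.eq
    rwa [Matrix.conjTranspose_eq_transpose_of_trivial] at this
  have h2 : (A⁻¹ *ᵥ y) ⬝ᵥ (A *ᵥ x) = x ⬝ᵥ y := by
    rw [Matrix.dotProduct_mulVec, ← Matrix.mulVec_transpose, hT, h1, dotProduct_comm]
  rw [star_trivial, Matrix.mulVec_sub, h1, sub_dotProduct, dotProduct_sub, dotProduct_sub,
    h2, dotProduct_comm (A⁻¹ *ᵥ y) y] at h
  linarith

lemma aux_quad {d : ℕ} {Ω : Type*} [MeasurableSpace Ω] (μ : Measure Ω)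
    (x : Ω → Fin d → ℝ) (hx : ∀ i, MemLp (fun ω => x ω i) 2 μ)
    (A C : Matrix (Fin d) (Fin d) ℝ) (hC : ∀ i j, C i j = ∫ ω, x ω i * x ω j ∂μ) :
    Integrable (fun ω => x ω ⬝ᵥ (A *ᵥ x ω)) μ ∧
      ∫ ω, x ω ⬝ᵥ (A *ᵥ x ω) ∂μ = (A * C).trace := by
  have e : (fun ω => x ω ⬝ᵥ (A *ᵥ x ω)) =
      fun ω => ∑ i, ∑ j, A i j * (x ω j * x ω i) := by
    funext ω
    simp only [dotProduct, Matrix.mulVec, Finset.mul_sum]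
    refine Finset.sum_congr rfl fun i _ => Finset.sum_congr rfl fun j _ => ?_
    ring
  have hi : ∀ i j, Integrable (fun ω => A i j * (x ω j * x ω i)) μ := fun i j =>
    ((hx j).integrable_mul (hx i)).const_mul _
  rw [e]
  refine ⟨integrable_finsetSum _ fun i _ => integrable_finsetSum _ fun j _ => hi i j, ?_⟩
  rw [integral_finsetSum _ fun i _ => integrable_finsetSum _ fun j _ => hi i j]
  simp only [Matrix.trace, Matrix.diag, Matrix.mul_apply]
  refine Finset.sum_congr rfl fun i _ => ?_
  rw [integral_finsetSum _ fun j _ => hi i j]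
  refine Finset.sum_congr rfl fun j _ => ?_
  rw [integral_const_mul, hC]

lemma aux_split {Ω : Type*} [MeasurableSpace Ω] (μ : Measure Ω) [IsProbabilityMeasure μ]
    (k : ℝ) (a b c e f : Ω → ℝ) (ha : Integrable a μ) (hb : Integrable b μ)
    (hc : Integrable c μ) (he : Integrable e μ) (hf : Integrable f μ) :
    ∫ ω, (k + a ω + b ω + c ω - e ω - f ω) ∂μ =
      k + ∫ ω, a ω ∂μ + ∫ ω, b ω ∂μ + ∫ ω, c ω ∂μ - ∫ ω, e ω ∂μ - ∫ ω, f ω ∂μ := by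
  have h0 : Integrable (fun _ : Ω => k) μ := integrable_const k
  have h1 : Integrable (fun ω => k + a ω) μ := h0.add ha
  have h2 : Integrable (fun ω => k + a ω + b ω) μ := h1.add hb
  have h3 : Integrable (fun ω => k + a ω + b ω + c ω) μ := h2.add hc
  have h4 : Integrable (fun ω => k + a ω + b ω + c ω - e ω) μ := h3.sub he
  rw [integral_sub h4 hf, integral_sub h3 he, integral_add h2 hc, integral_add h1 hb,
    integral_add h0 ha]
  simp

/-- Wasserstein lower bound on the transportation cost: for square integrable random
vectors `X, Y` in `ℝ^d` with means `X̂, Ŷ` and positive definite covariances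
`Σ_X, Σ_Y`, one has
`E[‖Y − X‖²] ≥ ‖Ŷ − X̂‖² + trace Σ_X + trace Σ_Y − 2 trace((Σ_Y^{1/2} Σ_X Σ_Y^{1/2})^{1/2})`
(Euclidean norm, so `‖v‖² = ∑ i, v i ^ 2`). -/
theorem transport_cost_lower_bound
    {d : ℕ} {Ω : Type*} [MeasurableSpace Ω] (μ : Measure Ω) [IsProbabilityMeasure μ]
    (X Y : Ω → Fin d → ℝ)
    (hX : ∀ i, MemLp (fun ω => X ω i) 2 μ)
    (hY : ∀ i, MemLp (fun ω => Y ω i) 2 μ)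
    (Xhat Yhat : Fin d → ℝ)
    (hXhat : ∀ i, Xhat i = ∫ ω, X ω i ∂μ)
    (hYhat : ∀ i, Yhat i = ∫ ω, Y ω i ∂μ)
    (CovX CovY : Matrix (Fin d) (Fin d) ℝ)
    (hCovX : ∀ i j, CovX i j = ∫ ω, (X ω i - Xhat i) * (X ω j - Xhat j) ∂μ)
    (hCovY : ∀ i j, CovY i j = ∫ ω, (Y ω i - Yhat i) * (Y ω j - Yhat j) ∂μ)
    (hpdX : CovX.PosDef) (hpdY : CovY.PosDef)
    -- `SY` is the unique symmetric positive definite square root of `CovY`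
    (SY Mh : Matrix (Fin d) (Fin d) ℝ)
    (hSY : SY.PosDef) (hSY2 : SY * SY = CovY)
    -- `Mh` is the unique symmetric positive definite square root of `SY * CovX * SY`
    (hMh : Mh.PosDef) (hMh2 : Mh * Mh = SY * CovX * SY) :
    (∑ i, (Yhat i - Xhat i) ^ 2) + CovX.trace + CovY.trace - 2 * Mh.trace ≤
      ∫ ω, ∑ i, (Y ω i - X ω i) ^ 2 ∂μ := by
  have hSu : IsUnit SY.det := (Matrix.isUnit_iff_isUnit_det SY).1 hSY.isUnit
  have hMu : IsUnit Mh.det := (Matrix.isUnit_iff_isUnit_det Mh).1 hMh.isUnit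
  have hST : SYᴴ = SY := hSY.isHermitian.eq
  have hA : (SY * Mh⁻¹ * SY).PosDef := by
    have h := hMh.inv.conjTranspose_mul_mul_same (B := SY)
      (Matrix.mulVec_injective_of_isUnit hSY.isUnit)
    rwa [hST] at h
  have hAX : ((SY * Mh⁻¹ * SY) * CovX).trace = Mh.trace := by
    have : (SY * Mh⁻¹ * SY) * CovX = SY * (Mh⁻¹ * (SY * CovX)) := by
      simp only [Matrix.mul_assoc]
    rw [this, Matrix.trace_mul_comm, Matrix.mul_assoc, ← hMh2, ← Matrix.mul_assoc,
      Matrix.nonsing_inv_mul _ hMu, Matrix.one_mul]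
  have hAY : ((SY * Mh⁻¹ * SY)⁻¹ * CovY).trace = Mh.trace := by
    rw [Matrix.mul_inv_rev, Matrix.mul_inv_rev, Matrix.nonsing_inv_nonsing_inv _ hMu, ← hSY2]
    have : SY⁻¹ * (Mh * SY⁻¹) * (SY * SY) = SY⁻¹ * (Mh * ((SY⁻¹ * SY) * SY)) := by
      simp only [Matrix.mul_assoc]
    rw [this, Matrix.nonsing_inv_mul _ hSu, Matrix.one_mul, Matrix.trace_mul_comm,
      Matrix.mul_assoc, Matrix.mul_nonsing_inv _ hSu, Matrix.mul_one]
  have hx : ∀ i, MemLp (fun ω => X ω i - Xhat i) 2 μ := fun i => (hX i).sub (memLp_const _)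
  have hy : ∀ i, MemLp (fun ω => Y ω i - Yhat i) 2 μ := fun i => (hY i).sub (memLp_const _)
  obtain ⟨iX, eX⟩ := aux_quad μ (fun ω i => X ω i - Xhat i) hx (SY * Mh⁻¹ * SY) CovX hCovX
  obtain ⟨iY, eY⟩ := aux_quad μ (fun ω i => Y ω i - Yhat i) hy (SY * Mh⁻¹ * SY)⁻¹ CovY hCovY
  obtain ⟨jX, fX⟩ := aux_quad μ (fun ω i => X ω i - Xhat i) hx 1 CovX hCovX
  obtain ⟨jY, fY⟩ := aux_quad μ (fun ω i => Y ω i - Yhat i) hy 1 CovY hCovY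
  simp only [Matrix.one_mulVec, Matrix.one_mul] at jX fX jY fY
  rw [hAX] at eX
  rw [hAY] at eY
  -- the linear term has mean zero
  have il : ∀ i, Integrable (fun ω =>
      2 * (Yhat i - Xhat i) * ((Y ω i - Yhat i) - (X ω i - Xhat i))) μ := fun i =>
    (((hy i).integrable one_le_two).sub ((hx i).integrable one_le_two)).const_mul _
  have iL : Integrable (fun ω => ∑ i,
      2 * (Yhat i - Xhat i) * ((Y ω i - Yhat i) - (X ω i - Xhat i))) μ :=
    integrable_finsetSum _ fun i _ => il i
  have eL : ∫ ω, ∑ i,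
      2 * (Yhat i - Xhat i) * ((Y ω i - Yhat i) - (X ω i - Xhat i)) ∂μ = 0 := by
    rw [integral_finsetSum _ fun i _ => il i]
    refine Finset.sum_eq_zero fun i _ => ?_
    rw [integral_const_mul, integral_sub ((hy i).integrable one_le_two)
      ((hx i).integrable one_le_two),
      integral_sub ((hY i).integrable one_le_two) (integrable_const _),
      integral_sub ((hX i).integrable one_le_two) (integrable_const _), ← hXhat, ← hYhat]
    simp
  have iR : Integrable (fun ω => ∑ i, (Y ω i - X ω i) ^ 2) μ :=
    integrable_finsetSum _ fun i _ => ((hY i).sub (hX i)).integrable_sq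
  have key : ∫ ω, ((∑ i, (Yhat i - Xhat i) ^ 2) +
      (∑ i, 2 * (Yhat i - Xhat i) * ((Y ω i - Yhat i) - (X ω i - Xhat i))) +
      ((fun i => X ω i - Xhat i) ⬝ᵥ (fun i => X ω i - Xhat i)) +
      ((fun i => Y ω i - Yhat i) ⬝ᵥ (fun i => Y ω i - Yhat i)) -
      ((fun i => X ω i - Xhat i) ⬝ᵥ ((SY * Mh⁻¹ * SY) *ᵥ (fun i => X ω i - Xhat i))) -
      ((fun i => Y ω i - Yhat i) ⬝ᵥ ((SY * Mh⁻¹ * SY)⁻¹ *ᵥ (fun i => Y ω i - Yhat i)))) ∂μ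
      ≤ ∫ ω, ∑ i, (Y ω i - X ω i) ^ 2 ∂μ := by
    refine integral_mono ((((((integrable_const _).add iL).add jX).add jY).sub iX).sub iY) iR ?_
    intro ω
    have hp := aux_pointwise _ hA (fun i => X ω i - Xhat i) (fun i => Y ω i - Yhat i)
    have hs : ∑ i, (Y ω i - X ω i) ^ 2 = (∑ i, (Yhat i - Xhat i) ^ 2) +
      (∑ i, 2 * (Yhat i - Xhat i) * ((Y ω i - Yhat i) - (X ω i - Xhat i))) +
      ((fun i => X ω i - Xhat i) ⬝ᵥ (fun i => X ω i - Xhat i)) +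
      ((fun i => Y ω i - Yhat i) ⬝ᵥ (fun i => Y ω i - Yhat i)) -
      2 * ((fun i => X ω i - Xhat i) ⬝ᵥ (fun i => Y ω i - Yhat i)) := by
      simp only [dotProduct, Finset.mul_sum, ← Finset.sum_add_distrib, ← Finset.sum_sub_distrib]
      refine Finset.sum_congr rfl fun i _ => ?_
      ring
    simp only
    rw [hs]
    linarith
  rw [aux_split μ _ _ _ _ _ _ iL jX jY iX iY, eL, eX, eY, fX, fY] at key
  linarith
end

section
/- Let X be a square-integrable zero-mean random vector in ℝ^d with positive definite covariance matrix Σ_X = E[XXᵀ]. Let Σ_Y be a symmetric positive definite d×d matrix and F := Σ_Y^{1/2} (Σ_Y^{1/2} Σ_X Σ_Y^{1/2})^{-1/2} Σ_Y^{1/2}. Define Y := F X. Then the covariance matrix of Y equals Σ_Y, and E[‖Y − X‖²] = trace(Σ_X) + trace(Σ_Y) − 2·trace((Σ_Y^{1/2} Σ_X Σ_Y^{1/2})^{1/2}); hence Y = FX achieves the transportation-cost lower bound trace(Σ_X) + trace(Σ_Y) − 2·trace((Σ_Y^{1/2} Σ_X Σ_Y^{1/2})^{1/2}). -/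
open MeasureTheory Matrix

lemma cov_aux {d : ℕ} {Ω : Type*} [MeasurableSpace Ω] (μ : Measure Ω)
    (X : Ω → Fin d → ℝ) (hX : ∀ i, MemLp (fun ω => X ω i) 2 μ)
    (C : Matrix (Fin d) (Fin d) ℝ)
    (hC : ∀ i j, C i j = ∫ ω, X ω i * X ω j ∂μ)
    (A : Matrix (Fin d) (Fin d) ℝ) (i j : Fin d) :
    Integrable (fun ω => A.mulVec (X ω) i * A.mulVec (X ω) j) μ ∧
    ∫ ω, A.mulVec (X ω) i * A.mulVec (X ω) j ∂μ = (A * C * Aᵀ) i j := by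
  have hint : ∀ k l, Integrable (fun ω => X ω k * X ω l) μ := fun k l =>
    (hX k).integrable_mul (hX l)
  have hint2 : ∀ k l, Integrable (fun ω => A i k * A j l * (X ω k * X ω l)) μ :=
    fun k l => (hint k l).const_mul _
  have e : (fun ω => A.mulVec (X ω) i * A.mulVec (X ω) j) =
      fun ω => ∑ l, ∑ k, A i k * A j l * (X ω k * X ω l) := by
    funext ω
    simp only [Matrix.mulVec, dotProduct, Finset.sum_mul_sum]
    rw [Finset.sum_comm]
    refine Finset.sum_congr rfl fun _ _ => Finset.sum_congr rfl fun _ _ => by ring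
  rw [e]
  refine ⟨integrable_finsetSum _ fun l _ => integrable_finsetSum _ fun k _ => hint2 k l, ?_⟩
  rw [integral_finsetSum _ fun l _ => integrable_finsetSum _ fun k _ => hint2 k l]
  simp only [Matrix.mul_apply, Matrix.transpose_apply, Finset.sum_mul]
  refine Finset.sum_congr rfl fun l _ => ?_
  rw [integral_finsetSum _ fun k _ => hint2 k l]
  refine Finset.sum_congr rfl fun k _ => ?_
  rw [integral_const_mul, hC]
  ring

/-- The optimal map achieves the Wasserstein lower bound: for a zero-mean square
integrable random vector `X` with positive definite covariance `Σ_X`, a symmetric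
positive definite matrix `Σ_Y`, and
`F = Σ_Y^{1/2} (Σ_Y^{1/2} Σ_X Σ_Y^{1/2})^{-1/2} Σ_Y^{1/2}`, the random vector
`Y = F X` has covariance `Σ_Y` and its transportation cost equals
`trace Σ_X + trace Σ_Y − 2 trace((Σ_Y^{1/2} Σ_X Σ_Y^{1/2})^{1/2})`. -/
theorem optimal_map_achieves_lower_bound
    {d : ℕ} {Ω : Type*} [MeasurableSpace Ω] (μ : Measure Ω) [IsProbabilityMeasure μ]
    (X : Ω → Fin d → ℝ)
    (hX : ∀ i, MemLp (fun ω => X ω i) 2 μ)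
    (hmean : ∀ i, ∫ ω, X ω i ∂μ = 0)
    (CovX : Matrix (Fin d) (Fin d) ℝ)
    (hCovX : ∀ i j, CovX i j = ∫ ω, X ω i * X ω j ∂μ)
    (hpdX : CovX.PosDef)
    (CovY : Matrix (Fin d) (Fin d) ℝ) (hpdY : CovY.PosDef)
    -- `SY` is the unique symmetric positive definite square root of `CovY`
    (SY Mh F : Matrix (Fin d) (Fin d) ℝ)
    (hSY : SY.PosDef) (hSY2 : SY * SY = CovY)
    -- `Mh` is the unique symmetric positive definite square root of `SY * CovX * SY`
    (hMh : Mh.PosDef) (hMh2 : Mh * Mh = SY * CovX * SY)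
    (hF : F = SY * Mh⁻¹ * SY)
    (Y : Ω → Fin d → ℝ) (hYdef : ∀ ω, Y ω = F.mulVec (X ω)) :
    (∀ i j,
        ∫ ω, (Y ω i - ∫ ω', Y ω' i ∂μ) * (Y ω j - ∫ ω', Y ω' j ∂μ) ∂μ = CovY i j) ∧
      ∫ ω, ∑ i, (Y ω i - X ω i) ^ 2 ∂μ =
        CovX.trace + CovY.trace - 2 * Mh.trace := by
  have hdet : IsUnit Mh.det := hMh.det_pos.ne'.isUnit
  have hSt : SYᵀ = SY := by simpa [Matrix.IsHermitian] using hSY.isHermitian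
  have hMt : Mhᵀ = Mh := by simpa [Matrix.IsHermitian] using hMh.isHermitian
  have hFt : Fᵀ = F := by
    rw [hF, Matrix.transpose_mul, Matrix.transpose_mul, Matrix.transpose_nonsing_inv, hSt, hMt,
      Matrix.mul_assoc]
  have hFCF : F * CovX * Fᵀ = CovY := by
    rw [hFt, hF]
    calc SY * Mh⁻¹ * SY * CovX * (SY * Mh⁻¹ * SY)
        = SY * Mh⁻¹ * (SY * CovX * SY) * Mh⁻¹ * SY := by simp only [Matrix.mul_assoc]
      _ = SY * ((Mh⁻¹ * Mh) * (Mh * Mh⁻¹)) * SY := by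
          rw [← hMh2]; simp only [Matrix.mul_assoc]
      _ = CovY := by
          rw [Matrix.nonsing_inv_mul _ hdet, Matrix.mul_nonsing_inv _ hdet, ← hSY2]; simp
  have htr : (F * CovX).trace = Mh.trace := by
    rw [hF]
    calc (SY * Mh⁻¹ * SY * CovX).trace = (SY * (Mh⁻¹ * SY * CovX)).trace := by
          simp only [Matrix.mul_assoc]
      _ = (Mh⁻¹ * (SY * CovX * SY)).trace := by
          rw [Matrix.trace_mul_comm]; simp only [Matrix.mul_assoc]
      _ = Mh.trace := by
          rw [← hMh2, ← Matrix.mul_assoc, Matrix.nonsing_inv_mul _ hdet, Matrix.one_mul]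
  have hYmean : ∀ i, ∫ ω, Y ω i ∂μ = 0 := by
    intro i
    simp only [hYdef, Matrix.mulVec, dotProduct]
    rw [integral_finsetSum _ fun k _ => ((hX k).integrable (by norm_num)).const_mul _]
    simp [integral_const_mul, hmean]
  refine ⟨fun i j => ?_, ?_⟩
  · simp only [hYmean, sub_zero]
    simp only [hYdef]
    rw [(cov_aux μ X hX CovX hCovX F i j).2, hFCF]
  · have e : ∀ ω i, (Y ω i - X ω i) ^ 2 =
        (F - 1).mulVec (X ω) i * (F - 1).mulVec (X ω) i := by
      intro ω i
      rw [hYdef, Matrix.sub_mulVec, Matrix.one_mulVec, Pi.sub_apply, sq]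
    simp only [e]
    rw [integral_finsetSum _ fun i _ => (cov_aux μ X hX CovX hCovX (F - 1) i i).1]
    simp only [(cov_aux μ X hX CovX hCovX (F - 1) _ _).2]
    change ((F - 1) * CovX * (F - 1)ᵀ).trace = _
    have e2 : (F - 1) * CovX * (F - 1)ᵀ = F * CovX * Fᵀ - F * CovX - CovX * F + CovX := by
      rw [Matrix.transpose_sub, hFt, Matrix.transpose_one]
      noncomm_ring
    rw [e2, hFCF, Matrix.trace_add, Matrix.trace_sub, Matrix.trace_sub,
      Matrix.trace_mul_comm CovX F, htr]
    ring
end
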